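/- Let P be a polynomial with complex coefficients of degree n, let Q(z) = z^n · conj(P(1/conj(z))) be its conjugate-reciprocal polynomial, and let a be a complex number with |a| ≤ 1. Then for every complex z with |z| ≥ 1, |S̃_a[P](z)| + |S̃_a[Q](z)| ≤ (n|z|^(n−1) + n|a|) · max_{|w|=1} |P(w)|. -/

import Mathlib

open Polynomial

/-- The modified Smirnov operator: S̃ₐ[P](z) = (1+az)·P′(z) − n·a·P(z). -/
noncomputable def smirnov (n : ℕ) (a : ℂ) (P : Polynomial ℂ) (z : ℂ) : ℂ :=
  (1 + a * z) * P.derivative.eval z - (n : ℂ) * a * P.eval z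

/-- The maximum of ‖P‖ on the unit circle. -/
noncomputable def maxCircle (P : Polynomial ℂ) : ℝ :=
  sSup {y : ℝ | ∃ w : ℂ, ‖w‖ = 1 ∧ y = ‖P.eval w‖}

open ComplexConjugate

/-- The polynomial `z ^ n * conj (P (1 / conj z))`. -/
noncomputable def conjReciprocal (n : ℕ) (P : Polynomial ℂ) : Polynomial ℂ :=
  (P.map (starRingEnd ℂ)).reflect n

theorem coeff_conjReciprocal {n k : ℕ} (P : Polynomial ℂ) (hk : k ≤ n) :
    (conjReciprocal n P).coeff k = conj (P.coeff (n - k)) := by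
  simp [conjReciprocal, coeff_reflect, revAt_le hk]

theorem natDegree_conjReciprocal_le {n : ℕ} {P : Polynomial ℂ} (hP : P.natDegree ≤ n) :
    (conjReciprocal n P).natDegree ≤ n := by
  refine natDegree_le_iff_coeff_eq_zero.2 fun k hk => ?_
  rw [conjReciprocal, coeff_reflect, revAt_eq_self_of_lt hk, coeff_map,
    coeff_eq_zero_of_natDegree_lt (hP.trans_lt hk), map_zero]

theorem eq_conjReciprocal {n : ℕ} {P : Polynomial ℂ} (hP : P.natDegree ≤ n) :
    ∑ k ∈ Finset.range (n + 1), C (conj (P.coeff (n - k))) * X ^ k = conjReciprocal n P := by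
  rw [(conjReciprocal n P).as_sum_range_C_mul_X_pow' (n := n + 1)
    (Nat.lt_succ_of_le (natDegree_conjReciprocal_le hP))]
  refine Finset.sum_congr rfl fun k hk => ?_
  rw [coeff_conjReciprocal P (Nat.lt_succ_iff.1 (Finset.mem_range.1 hk))]

theorem eval_conjReciprocal {n : ℕ} {P : Polynomial ℂ} (hP : P.natDegree ≤ n) {z : ℂ}
    (hz : z ≠ 0) : (conjReciprocal n P).eval z = z ^ n * conj (P.eval (conj z)⁻¹) := by
  let : Invertible z⁻¹ := invertibleOfNonzero (inv_ne_zero hz)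
  have h := eval₂_reflect_mul_pow (RingHom.id ℂ) z⁻¹ n (P.map (starRingEnd ℂ))
    (natDegree_map_le.trans hP)
  simp only [invOf_eq_inv, inv_inv, eval₂_id] at h
  have h' : conj (P.eval (conj z)⁻¹) = (P.map (starRingEnd ℂ)).eval z⁻¹ := by
    rw [← eval_map_apply]
    simp
  rw [h', ← h, conjReciprocal, mul_left_comm, ← mul_pow, mul_inv_cancel₀ hz, one_pow, mul_one]

theorem norm_sub_le_norm_mul_inv_conj_sub {z r : ℂ} (hz : 1 ≤ ‖z‖) (hr : 1 ≤ ‖r‖) :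
    ‖z - r‖ ≤ ‖z‖ * ‖(conj z)⁻¹ - r‖ := by
  have hz0 : conj z ≠ 0 := by
    rw [Ne, map_eq_zero]
    rintro rfl
    norm_num at hz
  have h : ‖z‖ * ‖(conj z)⁻¹ - r‖ = ‖1 - conj z * r‖ := by
    rw [← Complex.norm_conj z, ← norm_mul, mul_sub, mul_inv_cancel₀ hz0]
  rw [h]
  refine le_of_sq_le_sq ?_ (norm_nonneg _)
  have key : ‖1 - conj z * r‖ ^ 2 - ‖z - r‖ ^ 2 = (‖z‖ ^ 2 - 1) * (‖r‖ ^ 2 - 1) := by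
    simp only [Complex.sq_norm, Complex.normSq_apply]
    simp
    ring
  nlinarith [mul_nonneg (sub_nonneg.2 (one_le_pow₀ hz (n := 2)))
    (sub_nonneg.2 (one_le_pow₀ hr (n := 2)))]

theorem norm_multiset_map_prod (s : Multiset ℂ) (f : ℂ → ℂ) :
    ‖(s.map f).prod‖ = (s.map fun r => ‖f r‖).prod := by
  have h := map_multiset_prod (normHom (α := ℂ)) (s.map f)
  rwa [Multiset.map_map] at h

theorem norm_eval_le_norm_eval_conjReciprocal {n : ℕ} {F : Polynomial ℂ} (hF : F.natDegree = n)
    (hr : ∀ w, ‖w‖ ≤ 1 → F.eval w ≠ 0) {z : ℂ} (hz : 1 ≤ ‖z‖) :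
    ‖F.eval z‖ ≤ ‖(conjReciprocal n F).eval z‖ := by
  have hz0 : z ≠ 0 := by
    rintro rfl
    norm_num at hz
  have hs := IsAlgClosed.splits F
  have hc : n = F.roots.card := hF ▸ hs.natDegree_eq_card_roots
  rw [eval_conjReciprocal hF.le hz0, hs.eval_eq_prod_roots z, hs.eval_eq_prod_roots (conj z)⁻¹,
    norm_mul, norm_mul, Complex.norm_conj, norm_mul, norm_pow, mul_left_comm]
  gcongr
  rw [norm_multiset_map_prod, norm_multiset_map_prod, hc, ← Multiset.prod_replicate, ← Multiset.map_const',
    ← Multiset.prod_map_mul]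
  refine Multiset.prod_map_le_prod_map₀ _ _ (fun _ _ => norm_nonneg _) fun r hmem => ?_
  refine norm_sub_le_norm_mul_inv_conj_sub hz ?_
  by_contra! h
  exact hr r h.le (mem_roots'.1 hmem).2

theorem norm_leadingCoeff_le_norm_coeff_zero {F : Polynomial ℂ}
    (hr : ∀ w, ‖w‖ ≤ 1 → F.eval w ≠ 0) : ‖F.leadingCoeff‖ ≤ ‖F.coeff 0‖ := by
  have hs := IsAlgClosed.splits F
  rw [coeff_zero_eq_eval_zero, hs.eval_eq_prod_roots, norm_mul]
  refine le_mul_of_one_le_right (norm_nonneg _) ?_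
  rw [norm_multiset_map_prod]
  have h1 := Multiset.prod_map_le_prod_map₀ (s := F.roots) (fun _ => (1 : ℝ))
    (fun r => ‖0 - r‖) (fun _ _ => zero_le_one) fun r hmem => ?_
  · simpa using h1
  · by_contra! h
    exact hr r (by simpa using h.le) (mem_roots'.1 hmem).2

theorem re_pos_of_norm_lt_one {a z w : ℂ} (ha : ‖a‖ ≤ 1) (hz : 1 ≤ ‖z‖) (hw : ‖w‖ < 1)
    (haz : 1 + a * z ≠ 0) : 0 < ((z + conj a) * ((1 + a * w) / (z - w))).re := by
  have hzw : z - w ≠ 0 := by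
    rw [sub_ne_zero]
    rintro rfl
    linarith
  have key : 2 * ((z + conj a) * (1 + a * w) * conj (z - w)).re
      = (‖z‖ ^ 2 - 1) * ‖1 + a * w‖ ^ 2 + (1 - ‖a‖ ^ 2) * ‖z - w‖ ^ 2
        + ‖1 + a * z‖ ^ 2 * (1 - ‖w‖ ^ 2) := by
    simp only [Complex.sq_norm, Complex.normSq_apply]
    simp
    ring
  have h1 : 0 ≤ (‖z‖ ^ 2 - 1) * ‖1 + a * w‖ ^ 2 :=
    mul_nonneg (sub_nonneg.2 (one_le_pow₀ hz)) (sq_nonneg _)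
  have h2 : 0 ≤ (1 - ‖a‖ ^ 2) * ‖z - w‖ ^ 2 :=
    mul_nonneg (sub_nonneg.2 (pow_le_one₀ (norm_nonneg _) ha)) (sq_nonneg _)
  have h3 : 0 < ‖1 + a * z‖ ^ 2 * (1 - ‖w‖ ^ 2) :=
    mul_pos (pow_pos (norm_pos_iff.2 haz) 2)
      (sub_pos.2 (pow_lt_one₀ (norm_nonneg _) hw two_ne_zero))
  have heq : (z + conj a) * ((1 + a * w) / (z - w))
      = (((‖z - w‖ ^ 2)⁻¹ : ℝ) : ℂ) * ((z + conj a) * (1 + a * w) * conj (z - w)) := by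
    push_cast
    rw [← Complex.mul_conj']
    have : conj (z - w) ≠ 0 := by rwa [Ne, map_eq_zero]
    field_simp
  rw [heq, Complex.re_ofReal_mul]
  exact mul_pos (inv_pos.2 (pow_pos (norm_pos_iff.2 hzw) 2)) (by linarith)

/-- If all zeros of `G` lie in the open unit disc, then the modified Smirnov operator of `G` has
no zeros outside it. -/
theorem smirnov_ne_zero {n : ℕ} (hn : n ≠ 0) {G : Polynomial ℂ} (hG : G.natDegree = n)
    (hr : ∀ w, 1 ≤ ‖w‖ → G.eval w ≠ 0) {a z : ℂ} (ha : ‖a‖ ≤ 1) (hz : 1 ≤ ‖z‖) :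
    smirnov n a G z ≠ 0 := by
  intro h0
  have hGz := hr z hz
  by_cases haz : 1 + a * z = 0
  · have ha0 : a ≠ 0 := by
      rintro rfl
      simp at haz
    simp [smirnov, haz, hn, ha0, hGz] at h0
  have hs := IsAlgClosed.splits G
  have hlt : ∀ w ∈ G.roots, ‖w‖ < 1 := fun w hw => by
    by_contra! h
    exact hr w h (mem_roots'.1 hw).2
  have hsum : smirnov n a G z / G.eval z = (G.roots.map fun w => (1 + a * w) / (z - w)).sum := by
    have h1 : smirnov n a G z / G.eval z
        = (1 + a * z) * (G.derivative.eval z / G.eval z) - n * a := by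
      rw [smirnov]
      field_simp
    have h2 : (n : ℂ) * a = (G.roots.map fun _ => a).sum := by
      rw [Multiset.map_const', Multiset.sum_replicate, nsmul_eq_mul, ← hs.natDegree_eq_card_roots,
        hG]
    rw [h1, hs.eval_derivative_div_eval_of_ne_zero hGz, ← Multiset.sum_map_mul_left, h2,
      ← Multiset.sum_map_sub]
    refine congrArg Multiset.sum (Multiset.map_congr rfl fun w hw => ?_)
    have : z - w ≠ 0 := by
      rw [sub_ne_zero]
      rintro rfl
      linarith [hlt z hw]
    field_simp
    ring
  rw [h0, zero_div] at hsum
  have hre : (G.roots.map fun w => ((z + conj a) * ((1 + a * w) / (z - w))).re).sum = 0 := by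
    have h := map_multiset_sum Complex.reAddGroupHom
      (G.roots.map fun w => (z + conj a) * ((1 + a * w) / (z - w)))
    rw [Multiset.sum_map_mul_left, ← hsum, mul_zero, map_zero, Multiset.map_map] at h
    exact h.symm
  have hpos := Multiset.sum_lt_sum_of_nonempty (s := G.roots) (f := fun _ => (0 : ℝ))
    (g := fun w => ((z + conj a) * ((1 + a * w) / (z - w))).re)
    (hs.roots_ne_zero (hG ▸ hn))
    fun w hw => re_pos_of_norm_lt_one ha hz (hlt w hw) haz
  rw [hre, Multiset.map_const', Multiset.sum_replicate, smul_zero] at hpos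
  exact hpos.false

theorem smirnov_C_mul_sub_C_mul (n : ℕ) (a β γ z : ℂ) (F G : Polynomial ℂ) :
    smirnov n a (C β * F - C γ * G) z = β * smirnov n a F z - γ * smirnov n a G z := by
  simp [smirnov]
  ring

theorem smirnov_combination_ne_zero {n : ℕ} (hn : n ≠ 0) {F : Polynomial ℂ}
    (hF : F.natDegree = n) (hr : ∀ w, ‖w‖ ≤ 1 → F.eval w ≠ 0) {a z β γ : ℂ} (ha : ‖a‖ ≤ 1)
    (hz : 1 ≤ ‖z‖) (hβγ : ‖γ‖ < ‖β‖) :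
    β * smirnov n a (conjReciprocal n F) z - γ * smirnov n a F z ≠ 0 := by
  have hlt {x y : ℂ} (hx : x ≠ 0) (hyx : ‖y‖ ≤ ‖x‖) : β * x - γ * y ≠ 0 := by
    intro h
    have h' : ‖β‖ * ‖x‖ = ‖γ‖ * ‖y‖ := by rw [← norm_mul, ← norm_mul, sub_eq_zero.1 h]
    nlinarith [norm_pos_iff.2 hx, norm_nonneg γ]
  rw [← smirnov_C_mul_sub_C_mul]
  refine smirnov_ne_zero hn ?_ (fun w hw => ?_) ha hz
  · refine natDegree_eq_of_le_of_coeff_ne_zero ?_ ?_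
    · exact (natDegree_sub_le_iff_left ((natDegree_C_mul_le _ _).trans hF.le)).2
        ((natDegree_C_mul_le _ _).trans (natDegree_conjReciprocal_le hF.le))
    · rw [coeff_sub, coeff_C_mul, coeff_C_mul, coeff_conjReciprocal F le_rfl, Nat.sub_self]
      refine hlt ?_ ?_
      · rw [Ne, map_eq_zero, coeff_zero_eq_eval_zero]
        exact hr 0 (by simp)
      · rw [Complex.norm_conj, ← hF]
        exact norm_leadingCoeff_le_norm_coeff_zero hr
  · have hw0 : w ≠ 0 := by
      rintro rfl
      norm_num at hw
    rw [eval_sub, eval_C_mul, eval_C_mul]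
    refine hlt ?_ (norm_eval_le_norm_eval_conjReciprocal hF hr hw)
    rw [eval_conjReciprocal hF.le hw0]
    refine mul_ne_zero (pow_ne_zero _ hw0) ?_
    rw [Ne, map_eq_zero]
    refine hr _ ?_
    rw [norm_inv, Complex.norm_conj]
    exact inv_le_one_of_one_le₀ hw

theorem norm_smirnov_le_norm_smirnov_conjReciprocal {n : ℕ} (hn : n ≠ 0) {F : Polynomial ℂ}
    (hF : F.natDegree = n) (hr : ∀ w, ‖w‖ ≤ 1 → F.eval w ≠ 0) {a z : ℂ} (ha : ‖a‖ ≤ 1)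
    (hz : 1 ≤ ‖z‖) : ‖smirnov n a F z‖ ≤ ‖smirnov n a (conjReciprocal n F) z‖ := by
  by_contra! h
  exact smirnov_combination_ne_zero hn hF hr ha hz h (by ring)

theorem norm_eval_le_maxCircle (P : Polynomial ℂ) {w : ℂ} (hw : ‖w‖ ≤ 1) :
    ‖P.eval w‖ ≤ maxCircle P := by
  have hset : {y : ℝ | ∃ w : ℂ, ‖w‖ = 1 ∧ y = ‖P.eval w‖}
      = (fun w => ‖P.eval w‖) '' Metric.sphere 0 1 := by
    ext y
    simp [eq_comm]
  have hbdd : BddAbove {y : ℝ | ∃ w : ℂ, ‖w‖ = 1 ∧ y = ‖P.eval w‖} := by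
    rw [hset]
    exact ((isCompact_sphere 0 1).image P.continuous.norm).bddAbove
  refine Complex.norm_le_of_forall_mem_frontier_norm_le (U := Metric.ball (0 : ℂ) 1)
    (f := fun w => P.eval w) Metric.isBounded_ball P.differentiable.diffContOnCl (fun w hw => ?_) ?_
  · rw [frontier_ball _ one_ne_zero] at hw
    exact le_csSup hbdd ⟨w, by simpa using hw, rfl⟩
  · rw [closure_ball _ one_ne_zero]
    simpa using hw

theorem conjReciprocal_sub_C (n : ℕ) (P : Polynomial ℂ) (κ : ℂ) :
    conjReciprocal n (P - C κ) = conjReciprocal n P - C (conj κ) * X ^ n := by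
  simp [conjReciprocal, reflect_sub, Polynomial.map_sub, reflect_C]

theorem smirnov_sub_C (n : ℕ) (a κ z : ℂ) (P : Polynomial ℂ) :
    smirnov n a (P - C κ) z = smirnov n a P z + n * a * κ := by
  simp [smirnov]
  ring

theorem smirnov_sub_C_mul_X_pow {n : ℕ} (hn : n ≠ 0) (a κ z : ℂ) (P : Polynomial ℂ) :
    smirnov n a (P - C κ * X ^ n) z = smirnov n a P z - κ * (n * z ^ (n - 1)) := by
  obtain ⟨m, rfl⟩ := Nat.exists_eq_succ_of_ne_zero hn
  simp only [smirnov, derivative_sub, derivative_C_mul_X_pow, eval_sub, eval_mul, eval_C, eval_pow,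
    eval_X, Nat.succ_eq_add_one, Nat.add_sub_cancel]
  ring

theorem exists_norm_eq_one_and_norm_mul_eq (x : ℂ) : ∃ u : ℂ, ‖u‖ = 1 ∧ x = ‖x‖ * u :=
  ⟨Complex.exp (x.arg * Complex.I), Complex.norm_exp_ofReal_mul_I _,
    (Complex.norm_mul_exp_arg_mul_I x).symm⟩

theorem norm_smirnov_add_norm_smirnov_conjReciprocal_le {n : ℕ} (hn : n ≠ 0)
    {P : Polynomial ℂ} (hP : P.natDegree = n) {a z : ℂ} (ha : ‖a‖ ≤ 1) (hz : 1 ≤ ‖z‖) {K : ℝ}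
    (hK : maxCircle P < K) :
    ‖smirnov n a P z‖ + ‖smirnov n a (conjReciprocal n P) z‖
      ≤ (n * ‖z‖ ^ (n - 1) + n * ‖a‖) * K := by
  have hM0 : 0 ≤ maxCircle P :=
    (norm_nonneg _).trans (norm_eval_le_maxCircle P (w := 0) (by simp))
  have hdeg (κ : ℂ) : (P - C κ).natDegree = n := by rw [natDegree_sub_C, hP]
  have hroot {κ : ℂ} (hκ : maxCircle P < ‖κ‖) (w : ℂ) (hw : ‖w‖ ≤ 1) :
      (P - C κ).eval w ≠ 0 := by
    rw [eval_sub, eval_C, sub_ne_zero]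
    rintro rfl
    exact (norm_eval_le_maxCircle P hw).not_gt hκ
  have hz0 : z ≠ 0 := by
    rintro rfl
    norm_num at hz
  have hN0 : (n : ℂ) * z ^ (n - 1) ≠ 0 :=
    mul_ne_zero (Nat.cast_ne_zero.2 hn) (pow_ne_zero _ hz0)
  have hNn : ‖(n : ℂ) * z ^ (n - 1)‖ = n * ‖z‖ ^ (n - 1) := by simp
  set L := smirnov n a P z
  set L' := smirnov n a (conjReciprocal n P) z
  set N := (n : ℂ) * z ^ (n - 1)
  have hne {κ : ℂ} (hκ : maxCircle P < ‖κ‖) : L' - conj κ * N ≠ 0 := by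
    have h := smirnov_combination_ne_zero hn (hdeg κ) (hroot hκ) ha hz (β := 1) (γ := 0) (by simp)
    rwa [one_mul, zero_mul, sub_zero, conjReciprocal_sub_C, smirnov_sub_C_mul_X_pow hn] at h
  have hle {κ : ℂ} (hκ : maxCircle P < ‖κ‖) : ‖L + n * a * κ‖ ≤ ‖L' - conj κ * N‖ := by
    have h := norm_smirnov_le_norm_smirnov_conjReciprocal hn (hdeg κ) (hroot hκ) ha hz
    rwa [conjReciprocal_sub_C, smirnov_sub_C_mul_X_pow hn, smirnov_sub_C] at h
  have hL'le : ‖L'‖ ≤ K * ‖N‖ := by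
    by_contra! h
    refine hne (κ := conj (L' / N)) ?_ ?_
    · rw [Complex.norm_conj, norm_div, lt_div_iff₀ (norm_pos_iff.2 hN0)]
      nlinarith [norm_pos_iff.2 hN0]
    · rw [Complex.conj_conj, div_mul_cancel₀ _ hN0, sub_self]
  obtain ⟨u, hu, hLu⟩ := exists_norm_eq_one_and_norm_mul_eq L'
  obtain ⟨v, hv, hNv⟩ := exists_norm_eq_one_and_norm_mul_eq N
  have hv0 : v ≠ 0 := norm_ne_zero_iff.1 (hv ▸ one_ne_zero)
  have hκ : ‖conj (K * (u / v))‖ = K := by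
    rw [Complex.norm_conj, norm_mul, norm_div, hu, hv, Complex.norm_real, Real.norm_of_nonneg
      (hM0.trans hK.le), div_one, mul_one]
  have h := hle (hκ.symm ▸ hK)
  have h1 : ‖L' - conj (conj (K * (u / v))) * N‖ = K * ‖N‖ - ‖L'‖ := by
    have : L' - conj (conj (K * (u / v))) * N = -(((K * ‖N‖ - ‖L'‖ : ℝ) : ℂ) * u) := by
      rw [Complex.conj_conj]
      conv_lhs => rw [hLu, hNv]
      push_cast
      field_simp
      ring
    rw [this, norm_neg, norm_mul, hu, mul_one, Complex.norm_real,
      Real.norm_of_nonneg (sub_nonneg.2 hL'le)]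
  have h2 : ‖L‖ ≤ ‖L + n * a * conj (K * (u / v))‖ + n * ‖a‖ * K := by
    have h := norm_le_norm_add_norm_sub' L (L + n * a * conj (K * (u / v)))
    rw [sub_add_cancel_left, norm_neg, norm_mul, hκ, norm_mul, Complex.norm_natCast] at h
    exact h
  rw [h1, hNn] at h
  linarith

theorem statement12 (n : ℕ) (P Q : Polynomial ℂ) (hP : P.natDegree = n)
    (hQ : Q = ∑ k ∈ Finset.range (n + 1),
        Polynomial.C ((starRingEnd ℂ) (P.coeff (n - k))) * Polynomial.X ^ k)
    (a : ℂ) (ha : ‖a‖ ≤ 1) (z : ℂ) (hz : 1 ≤ ‖z‖) :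
    ‖smirnov n a P z‖ + ‖smirnov n a Q z‖
      ≤ ((n : ℝ) * ‖z‖ ^ (n - 1) + (n : ℝ) * ‖a‖) * maxCircle P := by
  rw [eq_conjReciprocal hP.le] at hQ
  subst hQ
  rcases eq_or_ne n 0 with rfl | hn
  · simp [smirnov, derivative_of_natDegree_zero hP,
      derivative_of_natDegree_zero (Nat.le_zero.1 (natDegree_conjReciprocal_le hP.le))]
  · have hlim : Filter.Tendsto (fun K : ℝ => (n * ‖z‖ ^ (n - 1) + n * ‖a‖) * K)
        (nhdsWithin (maxCircle P) (Set.Ioi (maxCircle P)))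
        (nhds ((n * ‖z‖ ^ (n - 1) + n * ‖a‖) * maxCircle P)) :=
      ((continuous_const_mul _).tendsto _).mono_left nhdsWithin_le_nhds
    refine ge_of_tendsto hlim ?_
    filter_upwards [self_mem_nhdsWithin] with K hK
    exact norm_smirnov_add_norm_smirnov_conjReciprocal_le hn hP ha hz hK
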